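/- arXiv:0906.4902 — 6 statements merged into one kernel-verified Lean document; each statement's English description precedes it below -/
import Mathlib

section
/- Let d ∈ ℕ, T > 0 and K > 0. Let A, B : ℝ^d → ℝ^d be twice continuously differentiable maps such that: the second derivative of C := A + B is a constant symmetric bilinear map (i.e. C is quadratic); the first and second derivatives of A are bounded on ℝ^d; A(0) = 0; and ‖B(x)‖ ≤ K‖x‖² and ‖dB(x)‖ ≤ K‖x‖ for all x ∈ ℝ^d. Let u : [0,T] → ℝ^d be continuously differentiable with u'(t) = C(u(t)) for all t ∈ [0,T], and let M := sup_{t∈[0,T]} ‖u(t)‖ < ∞. Then there exist Δt₀ > 0 and K' > 0, depending only on A, B, K, T and M, such that for every Δt ∈ (0, Δt₀], setting t_n = nΔt, every continuous function v : Ω_Δt → ℝ^d that is twice continuously differentiable on each square [t_n, t_{n+1}] × [t_n, t_{n+1}] and satisfies v(0,0) = u(0), ∂_t v(t, t_n) = B(v(t, t_n)) for t ∈ [t_n, t_{n+1}], and ∂_τ v(t, τ) = A(v(t, τ)) for (t, τ) ∈ [t_n, t_{n+1}] × [t_n, t_{n+1}] (for each n with t_{n+1} ≤ T + Δt), obeys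 the first-order error bound ‖v(t,t) − u(t)‖ ≤ K' Δt for all t ∈ [0,T]. -/
open Set

/-- Euler-step estimate: the trajectory of a field that is bounded by `Q` and `L`-Lipschitz on a
ball stays within the ball for a short time and follows the tangent line up to second order. -/
theorem norm_sub_euler_step_le {E : Type*} [NormedAddCommGroup E] [NormedSpace ℝ E]
    {F : E → E} {g : ℝ → E} {R Q L a b : ℝ} (hab : a ≤ b) (hL : 0 ≤ L)
    (hQ : ∀ x, ‖x‖ ≤ R → ‖F x‖ < Q)
    (hF : ∀ x y, ‖x‖ ≤ R → ‖y‖ ≤ R → ‖F x - F y‖ ≤ L * ‖x - y‖)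
    (hg : ∀ s ∈ Icc a b, HasDerivWithinAt g (F (g s)) (Icc a b) s)
    (hga : ‖g a‖ + 1 ≤ R) (hbQ : Q * (b - a) ≤ 1) :
    ‖g b - g a‖ ≤ Q * (b - a) ∧
      ‖g b - g a - (b - a) • F (g a)‖ ≤ L * Q * (b - a) ^ 2 := by
  have hQ0 : 0 < Q := (norm_nonneg _).trans_lt (hQ (g a) (by linarith))
  have hball : ∀ s ∈ Icc a b, ‖g s - g a‖ ≤ 1 → ‖g s‖ ≤ R := fun s _ h => by
    have := norm_le_norm_add_norm_sub' (g s) (g a)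
    linarith
  have hlin : ∀ s ∈ Icc a b, Q * (s - a) ≤ Q * (b - a) := fun s hs =>
    mul_le_mul_of_nonneg_left (by linarith [hs.2]) hQ0.le
  have hdist : ∀ s ∈ Icc a b, ‖g s - g a‖ ≤ Q * (s - a) := by
    refine fun s hs => image_norm_le_of_norm_deriv_right_lt_deriv_boundary'
      (f := fun s => g s - g a) (f' := fun s => F (g s)) (B := fun s => Q * (s - a))
      (B' := fun _ => Q) (a := a) (b := b) ?_ ?_ ?_ (by fun_prop) ?_ ?_ hs
    · exact fun s hs => ((hg s hs).continuousWithinAt).sub continuousWithinAt_const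
    · intro s hs
      exact ((hg s (Ico_subset_Icc_self hs)).sub_const (g a)).mono_of_mem_nhdsWithin
        (Icc_mem_nhdsGE_of_mem hs)
    · simp
    · intro s _
      simpa using ((((hasDerivAt_id s).sub_const a).const_mul Q).hasDerivWithinAt :
        HasDerivWithinAt _ _ (Ici s) s)
    · intro s hs h
      have hs := Ico_subset_Icc_self hs
      exact hQ _ (hball s hs (h.le.trans ((hlin s hs).trans hbQ)))
  refine ⟨hdist b (right_mem_Icc.2 hab), ?_⟩
  have key := norm_image_sub_le_of_norm_deriv_le_segment'
    (f := fun s => g s - (s - a) • F (g a)) (f' := fun s => F (g s) - F (g a))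
    (C := L * (Q * (b - a))) (a := a) (b := b) ?_ ?_ b (right_mem_Icc.2 hab)
  · convert key using 1
    · congr 1
      simp only [sub_self, zero_smul]
      abel
    · ring
  · intro s hs
    refine (hg s hs).sub ?_
    simpa using (((hasDerivAt_id s).sub_const a).smul_const (F (g a))).hasDerivWithinAt
  · intro s hs
    have hs := Ico_subset_Icc_self hs
    have hd := hdist s hs
    refine (hF _ _ (hball s hs (hd.trans ((hlin s hs).trans hbQ))) (by linarith)).trans ?_
    exact mul_le_mul_of_nonneg_left (hd.trans (hlin s hs)) hL

/-- A `C¹` map on a finite-dimensional space is bounded and Lipschitz on every centred ball. -/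
theorem ContDiff.exists_bound_lipschitz_on_ball {E : Type*} [NormedAddCommGroup E]
    [NormedSpace ℝ E] [FiniteDimensional ℝ E] {F : E → E} (hF : ContDiff ℝ 1 F) (R : ℝ) :
    ∃ N : ℝ, (∀ x, ‖x‖ ≤ R → ‖F x‖ ≤ N) ∧
      ∀ x y, ‖x‖ ≤ R → ‖y‖ ≤ R → ‖F x - F y‖ ≤ N * ‖x - y‖ := by
  have hcomp : IsCompact (Metric.closedBall (0 : E) R) := isCompact_closedBall _ _
  obtain ⟨N₀, h₀⟩ := hcomp.exists_bound_of_continuousOn hF.continuous.continuousOn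
  obtain ⟨N₁, h₁⟩ :=
    hcomp.exists_bound_of_continuousOn (hF.continuous_fderiv one_ne_zero).continuousOn
  refine ⟨max N₀ N₁, fun x hx => (h₀ x (by simpa using hx)).trans (le_max_left _ _),
    fun x y hx hy => ?_⟩
  refine ((convex_closedBall (0 : E) R).norm_image_sub_le_of_norm_fderiv_le
    (fun z _ => (hF.differentiable one_ne_zero).differentiableAt) h₁
    (by simpa using hy) (by simpa using hx)).trans ?_
  exact mul_le_mul_of_nonneg_right (le_max_right _ _) (norm_nonneg _)

/-- One Godunov step: if `x, y, z` are the start, intermediate and end values of the splitting and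
`p, q` those of the exact flow, the error grows by a factor `1 + 2Lh` plus a local error. -/
theorem norm_sub_le_of_godunov_step {E : Type*} [NormedAddCommGroup E] [NormedSpace ℝ E]
    {A B : E → E} {x y z p q : E} {h L Q : ℝ} (hh : 0 ≤ h) (hL : 0 ≤ L)
    (hy : ‖y - x‖ ≤ Q * h) (hyB : ‖y - x - h • B x‖ ≤ L * Q * h ^ 2)
    (hzA : ‖z - y - h • A y‖ ≤ L * Q * h ^ 2)
    (hq : ‖q - p - h • (A p + B p)‖ ≤ 2 * L * (2 * Q) * h ^ 2)
    (hAyx : ‖A y - A x‖ ≤ L * ‖y - x‖) (hAxp : ‖A x - A p‖ ≤ L * ‖x - p‖)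
    (hBxp : ‖B x - B p‖ ≤ L * ‖x - p‖) :
    ‖z - q‖ ≤ (1 + 2 * L * h) * ‖x - p‖ + 7 * L * Q * h ^ 2 := by
  have hid : z - q = (z - y - h • A y) + (y - x - h • B x) + h • (A y - A x)
      + (x - p) + h • (A x - A p) + h • (B x - B p) - (q - p - h • (A p + B p)) := by
    module
  have hsmul : ∀ {w : E} {r : ℝ}, ‖w‖ ≤ r → ‖h • w‖ ≤ h * r := fun hw => by
    rw [norm_smul, Real.norm_of_nonneg hh]
    exact mul_le_mul_of_nonneg_left hw hh
  have hyx := hsmul (hAyx.trans (mul_le_mul_of_nonneg_left hy hL))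
  rw [hid]
  calc _ ≤ L * Q * h ^ 2 + L * Q * h ^ 2 + h * (L * (Q * h)) + ‖x - p‖
        + h * (L * ‖x - p‖) + h * (L * ‖x - p‖) + 2 * L * (2 * Q) * h ^ 2 :=
        norm_sub_le_of_le (norm_add_le_of_le (norm_add_le_of_le (norm_add_le_of_le
          (norm_add_le_of_le (norm_add_le_of_le hzA hyB) hyx) le_rfl) (hsmul hAxp))
          (hsmul hBxp)) hq
    _ = _ := by ring

/-- The bound `c δ t exp (β t)` propagates through the error recursion. -/
theorem gronwall_step_le {β c δ s t e : ℝ} (hβ : 0 ≤ β) (hc : 0 ≤ c) (hδ : 0 ≤ δ) (hs : 0 ≤ s)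
    (hst : s ≤ t) (htδ : t - s ≤ δ) (he : e ≤ c * s * Real.exp (β * s) * δ) :
    (1 + β * (t - s)) * e + c * (t - s) ^ 2 ≤ c * t * Real.exp (β * t) * δ := by
  have h0 : 0 ≤ t - s := sub_nonneg.2 hst
  have hexp : 1 + β * (t - s) ≤ Real.exp (β * (t - s)) := by
    linarith [Real.add_one_le_exp (β * (t - s))]
  have hmul : Real.exp (β * (t - s)) * Real.exp (β * s) = Real.exp (β * t) := by
    rw [← Real.exp_add]; ring_nf
  have h1 : (1 + β * (t - s)) * e ≤ c * s * Real.exp (β * t) * δ := by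
    calc _ ≤ (1 + β * (t - s)) * (c * s * Real.exp (β * s) * δ) :=
          mul_le_mul_of_nonneg_left he (by positivity)
      _ ≤ Real.exp (β * (t - s)) * (c * s * Real.exp (β * s) * δ) :=
          mul_le_mul_of_nonneg_right hexp (by positivity)
      _ = _ := by rw [← hmul]; ring
  have h2 : c * (t - s) ^ 2 ≤ c * (t - s) * Real.exp (β * t) * δ := by
    have h3 : (1 : ℝ) ≤ Real.exp (β * t) := Real.one_le_exp (mul_nonneg hβ (hs.trans hst))
    calc c * (t - s) ^ 2 = c * (t - s) * 1 * (t - s) := by ring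
      _ ≤ _ := by gcongr
  linarith

/-- **First-order convergence of Godunov splitting for quadratic ODEs.**
Let `A, B : ℝ^d → ℝ^d` be `C²` with `C = A + B` quadratic (constant second
derivative), `dA, d²A` bounded, `A 0 = 0`, `‖B x‖ ≤ K ‖x‖²`, `‖dB x‖ ≤ K ‖x‖`.
Then there are `Δt₀ > 0` and `K' > 0`, depending only on `A, B, K, T, M`, such
that for any solution `u` of `u' = C(u)` on `[0,T]` with `‖u‖ ≤ M`, any
`Δt ∈ (0, Δt₀]` and any doubled-time splitting solution `v` on
`Ω_Δt = ⋃_n [t_n,t_{n+1}]²` (continuous on `Ω_Δt`, `C²` on each square,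
`v(0,0) = u(0)`, `∂_t v(t,t_n) = B(v(t,t_n))`, `∂_τ v(t,τ) = A(v(t,τ))`),
one has `‖v(t,t) - u(t)‖ ≤ K' Δt` on `[0,T]`. -/
theorem godunov_ode_first_order (d : ℕ) (T K : ℝ) (hT : 0 < T) (hK : 0 < K)
    (A B : EuclideanSpace ℝ (Fin d) → EuclideanSpace ℝ (Fin d))
    (hA : ContDiff ℝ 2 A) (hB : ContDiff ℝ 2 B)
    (hquad : ∀ x y : EuclideanSpace ℝ (Fin d),
      iteratedFDeriv ℝ 2 (fun z => A z + B z) x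
        = iteratedFDeriv ℝ 2 (fun z => A z + B z) y)
    (hAbdd : ∃ C₀ : ℝ, ∀ x : EuclideanSpace ℝ (Fin d),
      ‖fderiv ℝ A x‖ ≤ C₀ ∧ ‖iteratedFDeriv ℝ 2 A x‖ ≤ C₀)
    (hA0 : A 0 = 0)
    (hBbdd : ∀ x : EuclideanSpace ℝ (Fin d),
      ‖B x‖ ≤ K * ‖x‖ ^ 2 ∧ ‖fderiv ℝ B x‖ ≤ K * ‖x‖)
    (M : ℝ) :
    ∃ Δt₀ : ℝ, 0 < Δt₀ ∧ ∃ K' : ℝ, 0 < K' ∧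
      ∀ u : ℝ → EuclideanSpace ℝ (Fin d),
        ContDiffOn ℝ 1 u (Icc 0 T) →
        (∀ t ∈ Icc (0 : ℝ) T, HasDerivWithinAt u (A (u t) + B (u t)) (Icc 0 T) t) →
        (∀ t ∈ Icc (0 : ℝ) T, ‖u t‖ ≤ M) →
      ∀ Δt : ℝ, 0 < Δt → Δt ≤ Δt₀ →
      ∀ v : ℝ → ℝ → EuclideanSpace ℝ (Fin d),
        ContinuousOn (fun p : ℝ × ℝ => v p.1 p.2)
          (⋃ n ∈ {n : ℕ | (n : ℝ) * Δt ≤ T},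
            Icc ((n : ℝ) * Δt) (((n : ℝ) + 1) * Δt) ×ˢ
              Icc ((n : ℝ) * Δt) (((n : ℝ) + 1) * Δt)) →
        (∀ n : ℕ, (n : ℝ) * Δt ≤ T →
          ContDiffOn ℝ 2 (fun p : ℝ × ℝ => v p.1 p.2)
            (Icc ((n : ℝ) * Δt) (((n : ℝ) + 1) * Δt) ×ˢ
              Icc ((n : ℝ) * Δt) (((n : ℝ) + 1) * Δt))) →
        v 0 0 = u 0 →
        (∀ n : ℕ, (n : ℝ) * Δt ≤ T →
          ∀ t ∈ Icc ((n : ℝ) * Δt) (((n : ℝ) + 1) * Δt),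
            HasDerivWithinAt (fun s => v s ((n : ℝ) * Δt))
              (B (v t ((n : ℝ) * Δt)))
              (Icc ((n : ℝ) * Δt) (((n : ℝ) + 1) * Δt)) t) →
        (∀ n : ℕ, (n : ℝ) * Δt ≤ T →
          ∀ t ∈ Icc ((n : ℝ) * Δt) (((n : ℝ) + 1) * Δt),
          ∀ τ ∈ Icc ((n : ℝ) * Δt) (((n : ℝ) + 1) * Δt),
            HasDerivWithinAt (fun σ => v t σ) (A (v t τ))
              (Icc ((n : ℝ) * Δt) (((n : ℝ) + 1) * Δt)) τ) →
      ∀ t ∈ Icc (0 : ℝ) T, ‖v t t - u t‖ ≤ K' * Δt := by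
  obtain ⟨NA, hNA, hLA⟩ :=
    (hA.of_le one_le_two).exists_bound_lipschitz_on_ball (|M| + 3)
  obtain ⟨NB, hNB, hLB⟩ :=
    (hB.of_le one_le_two).exists_bound_lipschitz_on_ball (|M| + 3)
  set L : ℝ := |NA| + |NB| + 1 with hLdef
  have hL : 0 < L := by positivity
  have hNAL : NA < L := by linarith [le_abs_self NA, abs_nonneg NB]
  have hNBL : NB < L := by linarith [le_abs_self NB, abs_nonneg NA]
  replace hNA : ∀ x, ‖x‖ ≤ |M| + 3 → ‖A x‖ < L := fun x hx => (hNA x hx).trans_lt hNAL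
  replace hNB : ∀ x, ‖x‖ ≤ |M| + 3 → ‖B x‖ < L := fun x hx => (hNB x hx).trans_lt hNBL
  replace hLA : ∀ x y, ‖x‖ ≤ |M| + 3 → ‖y‖ ≤ |M| + 3 → ‖A x - A y‖ ≤ L * ‖x - y‖ :=
    fun x y hx hy => (hLA x y hx hy).trans
      (mul_le_mul_of_nonneg_right hNAL.le (norm_nonneg _))
  replace hLB : ∀ x y, ‖x‖ ≤ |M| + 3 → ‖y‖ ≤ |M| + 3 → ‖B x - B y‖ ≤ L * ‖x - y‖ :=
    fun x y hx hy => (hLB x y hx hy).trans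
      (mul_le_mul_of_nonneg_right hNBL.le (norm_nonneg _))
  have hNC : ∀ x, ‖x‖ ≤ |M| + 3 → ‖A x + B x‖ < 2 * L := fun x hx => by
    linarith [norm_add_le (A x) (B x), hNA x hx, hNB x hx]
  have hLC : ∀ x y, ‖x‖ ≤ |M| + 3 → ‖y‖ ≤ |M| + 3 →
      ‖(A x + B x) - (A y + B y)‖ ≤ 2 * L * ‖x - y‖ := fun x y hx hy => by
    rw [add_sub_add_comm]
    linarith [norm_add_le (A x - A y) (B x - B y), hLA x y hx hy, hLB x y hx hy]
  set K' : ℝ := 7 * L * L * T * Real.exp (2 * L * T) with hK'def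
  have hK' : 0 < K' := by positivity
  refine ⟨1 / (2 * L + K'), by positivity, K', hK', ?_⟩
  intro u _ hu huM δ hδ hδ₀ v _ _ hv0 hvB hvA
  have hδ₁ : (2 * L + K') * δ ≤ 1 := by
    rwa [le_div_iff₀ (by positivity), mul_comm] at hδ₀
  have hK'δ : K' * δ ≤ 1 := by nlinarith [mul_pos hL hδ]
  have hLδ : 2 * L * δ ≤ 1 := by nlinarith [mul_pos hK' hδ]
  have hmono : ∀ t ∈ Icc (0 : ℝ) T,
      7 * L * L * t * Real.exp (2 * L * t) * δ ≤ K' * δ := fun t ht => by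
    have h1 := ht.1
    have h2 := ht.2
    rw [hK'def]
    gcongr
  have step : ∀ n : ℕ, ∀ t ∈ Icc ((n : ℝ) * δ) (((n : ℝ) + 1) * δ), t ≤ T →
      ‖v (n * δ) (n * δ) - u (n * δ)‖
        ≤ 7 * L * L * (n * δ) * Real.exp (2 * L * (n * δ)) * δ →
      ‖v t t - u t‖ ≤ 7 * L * L * t * Real.exp (2 * L * t) * δ := by
    intro n t ht htT he
    have hs0 : (0 : ℝ) ≤ n * δ := by positivity
    have hsT : (n : ℝ) * δ ≤ T := ht.1.trans htT
    specialize hvB n hsT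
    specialize hvA n hsT t ht
    set s : ℝ := n * δ
    have hts : t - s ≤ δ := by
      have := ht.2
      simp only [s]
      linarith
    have h0 : 0 ≤ t - s := sub_nonneg.2 ht.1
    have hsub : Icc s t ⊆ Icc s (((n : ℝ) + 1) * δ) := Icc_subset_Icc_right ht.2
    have hLh : L * (t - s) ≤ 1 / 2 := by nlinarith
    have hus : ‖u s‖ ≤ |M| := (huM s ⟨hs0, hsT⟩).trans (le_abs_self M)
    have hvs : ‖v s s‖ ≤ |M| + 1 := by
      linarith [norm_le_norm_add_norm_sub' (v s s) (u s), hmono s ⟨hs0, hsT⟩]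
    obtain ⟨hy, hyB⟩ := norm_sub_euler_step_le (g := fun r => v r s) ht.1 hL.le hNB hLB
      (fun r hr => (hvB r (hsub hr)).mono hsub) (by linarith) (by linarith)
    have hyn : ‖v t s‖ ≤ |M| + 2 := by
      linarith [norm_le_norm_add_norm_sub' (v t s) (v s s)]
    obtain ⟨-, hzA⟩ := norm_sub_euler_step_le (g := v t) ht.1 hL.le hNA hLA
      (fun r hr => (hvA r (hsub hr)).mono hsub) (by linarith) (by linarith)
    have hsub' : Icc s t ⊆ Icc 0 T := Icc_subset_Icc hs0 htT
    obtain ⟨-, hq⟩ := norm_sub_euler_step_le (F := fun x => A x + B x) (g := u) ht.1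
      (by positivity) hNC hLC (fun r hr => (hu r (hsub' hr)).mono hsub')
      (by linarith) (by linarith)
    refine (norm_sub_le_of_godunov_step h0 hL.le hy hyB hzA hq
      (hLA _ _ (by linarith) (by linarith)) (hLA _ _ (by linarith) (by linarith))
      (hLB _ _ (by linarith) (by linarith))).trans ?_
    exact gronwall_step_le (by positivity) (by positivity) hδ.le hs0 ht.1 hts he
  have grid : ∀ n : ℕ, (n : ℝ) * δ ≤ T → ‖v (n * δ) (n * δ) - u (n * δ)‖
      ≤ 7 * L * L * (n * δ) * Real.exp (2 * L * (n * δ)) * δ := by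
    intro n
    induction n with
    | zero => simp [hv0]
    | succ n ih =>
      intro hn
      push_cast at hn ⊢
      exact step n _ ⟨by linarith, le_rfl⟩ hn (ih (by linarith))
  intro t ht
  have hfl : ((⌊t / δ⌋₊ : ℕ) : ℝ) * δ ≤ t :=
    (le_div_iff₀ hδ).1 (Nat.floor_le (div_nonneg ht.1 hδ.le))
  have hfu : t ≤ ((⌊t / δ⌋₊ : ℕ) + 1 : ℝ) * δ :=
    ((div_lt_iff₀ hδ).1 (Nat.lt_floor_add_one _)).le
  exact (step _ t ⟨hfl, hfu⟩ ht.2 (grid _ (hfl.trans ht.2))).trans (hmono t ht)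
end

section
/- Let u₀ ∈ (0,1), Δt > 0, N ∈ ℕ, and set t_n = nΔt and D_n = (1 − e^{−Δt}) e^{t_n} + u₀ Δt (1 − e^{t_n}). Assume D_n > 0 for all 0 ≤ n ≤ N. Define the Godunov splitting sequence for the logistic equation by a₀ = u₀ and a_{n+1} = e^{−Δt} a_n / (1 − a_n Δt), i.e. a_{n+1} = Φ_A(Δt)(Φ_B(Δt)(a_n)) where Φ_B(h)(x) = x/(1 − x h) and Φ_A(h)(x) = e^{−h} x. Then for every 0 ≤ n ≤ N the sequence is well defined (in particular 1 − a_n Δt > 0 for n < N) and a_n = u₀ (1 − e^{−Δt}) / D_n. -/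
/-- **Closed form of the Godunov splitting for the logistic equation.**
With `Φ_B(h)(x) = x/(1 - x h)`, `Φ_A(h)(x) = e^{-h} x`, `t_n = n Δt` and
`D_n = (1 - e^{-Δt}) e^{t_n} + u₀ Δt (1 - e^{t_n})`, if `D_n > 0` for `0 ≤ n ≤ N`
then the Godunov iterates `a₀ = u₀`, `a_{n+1} = e^{-Δt} a_n / (1 - a_n Δt)` are
well defined (the denominators are positive) and
`a_n = u₀ (1 - e^{-Δt}) / D_n` for `0 ≤ n ≤ N`. -/
theorem godunov_logistic_closed_form (u₀ Δt : ℝ) (N : ℕ)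
    (hu₀ : u₀ ∈ Set.Ioo (0 : ℝ) 1) (hΔt : 0 < Δt)
    (D : ℕ → ℝ)
    (hD : ∀ n : ℕ, D n = (1 - Real.exp (-Δt)) * Real.exp ((n : ℝ) * Δt)
        + u₀ * Δt * (1 - Real.exp ((n : ℝ) * Δt)))
    (hDpos : ∀ n : ℕ, n ≤ N → 0 < D n)
    (a : ℕ → ℝ)
    (ha0 : a 0 = u₀)
    (harec : ∀ n : ℕ, n < N →
      a (n + 1) = Real.exp (-Δt) * a n / (1 - a n * Δt)) :
    (∀ n : ℕ, n < N → 0 < 1 - a n * Δt) ∧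
    (∀ n : ℕ, n ≤ N → a n = u₀ * (1 - Real.exp (-Δt)) / D n) := by
  have hstep (n : ℕ) :
      Real.exp (-Δt) * D (n + 1) = D n - u₀ * (1 - Real.exp (-Δt)) * Δt := by
    have hexp : Real.exp (-Δt) * Real.exp (((n + 1 : ℕ) : ℝ) * Δt)
        = Real.exp ((n : ℝ) * Δt) := by
      rw [← Real.exp_add]
      push_cast
      ring_nf
    rw [hD, hD]
    linear_combination (1 - Real.exp (-Δt) - u₀ * Δt) * hexp
  have hden (n : ℕ) (hn : n ≤ N) (han : a n = u₀ * (1 - Real.exp (-Δt)) / D n) :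
      1 - a n * Δt = Real.exp (-Δt) * D (n + 1) / D n := by
    have := (hDpos n hn).ne'
    rw [hstep, han]
    field_simp
  have hclosed : ∀ n : ℕ, n ≤ N → a n = u₀ * (1 - Real.exp (-Δt)) / D n := by
    intro n
    induction n with
    | zero =>
      intro h
      have hD0 : D 0 = 1 - Real.exp (-Δt) := by simp [hD]
      have hne := (hDpos 0 h).ne'
      rw [ha0, ← hD0, mul_div_cancel_right₀ _ hne]
    | succ n ih =>
      intro h
      have hn : n ≤ N := Nat.le_of_succ_le h
      have hne := (hDpos n hn).ne'
      have hne' := (hDpos (n + 1) h).ne'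
      have hq := (Real.exp_pos (-Δt)).ne'
      rw [harec n h, hden n hn (ih hn), ih hn]
      field_simp
  refine ⟨fun n hn => ?_, hclosed⟩
  rw [hden n hn.le (hclosed n hn.le)]
  exact div_pos (mul_pos (Real.exp_pos _) (hDpos (n + 1) hn)) (hDpos n hn.le)
end

section
/- Let u₀ ∈ (0,1), Δt > 0, N ∈ ℕ, set t_n = nΔt and E_n = (1 − e^{−Δt}) e^{t_n} + u₀ Δt (1 − e^{t_n})(1 + e^{−Δt})/2, and assume E_n > 0 for all 0 ≤ n ≤ N. Define the Strang splitting sequence for the logistic equation by a₀ = u₀ and a_{n+1} = Φ_B(Δt/2)(Φ_A(Δt)(Φ_B(Δt/2)(a_n))), where Φ_B(h)(x) = x/(1 − x h) and Φ_A(h)(x) = e^{−h} x; explicitly the one-step map is a ↦ e^{−Δt} a / (1 − a Δt (1 + e^{−Δt})/2). Then for every 0 ≤ n ≤ N the sequence is well defined (all intermediate denominators are positive) and a_n = u₀ (1 − e^{−Δt}) / E_n. -/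
/-- **Closed form of the Strang splitting for the logistic equation.**
With `Φ_B(h)(x) = x/(1 - x h)`, `Φ_A(h)(x) = e^{-h} x`, `t_n = n Δt` and
`E_n = (1 - e^{-Δt}) e^{t_n} + u₀ Δt (1 - e^{t_n})(1 + e^{-Δt})/2`, if `E_n > 0`
for `0 ≤ n ≤ N` then the Strang iterates
`a₀ = u₀`, `a_{n+1} = Φ_B(Δt/2)(Φ_A(Δt)(Φ_B(Δt/2)(a_n)))`, explicitly
`a_{n+1} = e^{-Δt} a_n / (1 - a_n Δt (1 + e^{-Δt})/2)`, are well defined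
(all intermediate denominators are positive) and `a_n = u₀ (1 - e^{-Δt}) / E_n`. -/
theorem strang_logistic_closed_form (u₀ Δt : ℝ) (N : ℕ)
    (hu₀ : u₀ ∈ Set.Ioo (0 : ℝ) 1) (hΔt : 0 < Δt)
    (E : ℕ → ℝ)
    (hE : ∀ n : ℕ, E n = (1 - Real.exp (-Δt)) * Real.exp ((n : ℝ) * Δt)
        + u₀ * Δt * (1 - Real.exp ((n : ℝ) * Δt)) * (1 + Real.exp (-Δt)) / 2)
    (hEpos : ∀ n : ℕ, n ≤ N → 0 < E n)
    (a : ℕ → ℝ)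
    (ha0 : a 0 = u₀)
    (harec : ∀ n : ℕ, n < N →
      a (n + 1) = Real.exp (-Δt) * a n / (1 - a n * Δt * (1 + Real.exp (-Δt)) / 2)) :
    (∀ n : ℕ, n < N →
      0 < 1 - a n * (Δt / 2) ∧
      0 < 1 - Real.exp (-Δt) * (a n / (1 - a n * (Δt / 2))) * (Δt / 2)) ∧
    (∀ n : ℕ, n ≤ N → a n = u₀ * (1 - Real.exp (-Δt)) / E n) := by
  have hq : 0 < Real.exp (-Δt) := Real.exp_pos _
  have hq1 : Real.exp (-Δt) < 1 := Real.exp_lt_one_iff.mpr (by linarith)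
  have hErec : ∀ n : ℕ, Real.exp (-Δt) * E (n + 1)
      = E n - u₀ * Δt * (1 + Real.exp (-Δt)) / 2 * (1 - Real.exp (-Δt)) := by
    intro n
    have hexp : Real.exp (-Δt) * Real.exp (((n + 1 : ℕ) : ℝ) * Δt)
        = Real.exp ((n : ℝ) * Δt) := by
      rw [← Real.exp_add]
      congr 1
      push_cast
      ring
    rw [hE, hE]
    linear_combination
      (1 - Real.exp (-Δt) - u₀ * Δt * (1 + Real.exp (-Δt)) / 2) * hexp
  have hden : ∀ n : ℕ, n < N → a n = u₀ * (1 - Real.exp (-Δt)) / E n →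
      1 - a n * Δt * (1 + Real.exp (-Δt)) / 2 = Real.exp (-Δt) * E (n + 1) / E n := by
    intro n hn han
    have hEn := (hEpos n hn.le).ne'
    rw [hErec, han]
    field_simp
  have hclosed : ∀ n : ℕ, n ≤ N → a n = u₀ * (1 - Real.exp (-Δt)) / E n := by
    intro n
    induction n with
    | zero =>
      intro _
      have h0 : E 0 = 1 - Real.exp (-Δt) := by simp [hE]
      rw [ha0, h0, mul_div_cancel_right₀ _ (by linarith)]
    | succ n ih =>
      intro hn
      have han := ih (by omega)
      have hEn := (hEpos n (by omega)).ne'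
      have hEn' := (hEpos (n + 1) hn).ne'
      rw [harec n hn, hden n hn han, han]
      field_simp
  refine ⟨fun n hn => ?_, hclosed⟩
  have han := hclosed n hn.le
  have hEn := hEpos n hn.le
  have ha : 0 < a n := by
    rw [han]
    exact div_pos (mul_pos hu₀.1 (by linarith)) hEn
  have hpos : 0 < 1 - a n * Δt * (1 + Real.exp (-Δt)) / 2 := by
    rw [hden n hn han]
    exact div_pos (mul_pos hq (hEpos (n + 1) hn)) hEn
  have hfirst : 0 < 1 - a n * (Δt / 2) := by
    have : 0 < a n * Δt * Real.exp (-Δt) := by positivity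
    linarith
  refine ⟨hfirst, ?_⟩
  have hsecond : 1 - Real.exp (-Δt) * (a n / (1 - a n * (Δt / 2))) * (Δt / 2)
      = (1 - a n * Δt * (1 + Real.exp (-Δt)) / 2) / (1 - a n * (Δt / 2)) := by
    have hcancel := div_mul_cancel₀ (a n) hfirst.ne'
    rw [eq_div_iff hfirst.ne']
    linear_combination -(Real.exp (-Δt) * (Δt / 2)) * hcancel
  rw [hsecond]
  exact div_pos hpos hfirst
end

section
/- Let u₀ ∈ (0,1) and T > 0, and let u(t) = u₀/(u₀ + e^t(1 − u₀)) be the exact solution of the logistic equation u' = u(u − 1) with u(0) = u₀. Then there exist Δt₀ > 0 and C > 0, depending only on u₀ and T, such that for every Δt ∈ (0, Δt₀] the Strang splitting sequence a₀ = u₀, a_{n+1} = e^{−Δt} a_n / (1 − a_n Δt (1 + e^{−Δt})/2) is well defined for all n with nΔt ≤ T and satisfies the second-order error bound |a_n − u(nΔt)| ≤ C Δt² for all such n. -/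
theorem exp_sub_one_bounds {h : ℝ} (h0 : 0 < h) (h1 : h ≤ 1) :
    2 * (Real.exp h - 1) ≤ h * (Real.exp h + 1) ∧
      h * (Real.exp h + 1) ≤ 2 * (1 + h ^ 2) * (Real.exp h - 1) := by
  have hlow := Real.quadratic_le_exp_of_nonneg h0.le
  have hup : Real.exp h ≤ 1 + h + h ^ 2 / 2 + 2 / 9 * h ^ 3 := by
    have hb := Real.exp_bound (x := h) (by rwa [abs_of_pos h0]) (n := 3) (by norm_num)
    rw [abs_of_pos h0] at hb
    have hb' := (abs_le.1 hb).2
    norm_num [Finset.sum_range_succ, Nat.factorial] at hb'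
    linarith
  have h3 : 0 < h ^ 3 := by positivity
  have h4 : 0 < h ^ 4 := by positivity
  constructor
  · have := mul_le_mul_of_nonneg_left hup (by linarith : 0 ≤ 2 - h)
    nlinarith
  · have := mul_le_mul_of_nonneg_left hlow (by nlinarith : 0 ≤ 1 + h ^ 2 - h / 2)
    nlinarith

/-- One Strang step is affine in the reciprocal, with fixed point `K`. -/
theorem strang_step_closed_form {u K h P : ℝ} (h0 : 0 < h)
    (hK : 2 * K * (Real.exp h - 1) = h * (Real.exp h + 1))
    (huK : u * K ≤ 1) (hP : 1 ≤ P) :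
    Real.exp (-h) * (u / (1 + (P - 1) * (1 - u * K))) /
        (1 - u / (1 + (P - 1) * (1 - u * K)) * h * (1 + Real.exp (-h)) / 2) =
      u / (1 + (P * Real.exp h - 1) * (1 - u * K)) := by
  have hx : 1 < Real.exp h := Real.one_lt_exp_iff.2 h0
  rw [Real.exp_neg]
  generalize Real.exp h = x at *
  have hx0 : 0 < x := by linarith
  have hD : 0 < 1 + (P - 1) * (1 - u * K) := by
    have := mul_nonneg (sub_nonneg.2 hP) (sub_nonneg.2 huK)
    linarith
  have hD' : 0 < 1 + (P * x - 1) * (1 - u * K) := by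
    have : 0 ≤ P * x - 1 := by nlinarith
    have := mul_nonneg this (sub_nonneg.2 huK)
    linarith
  have hrel : x * (1 + (P - 1) * (1 - u * K)) - u * h * (x + 1) / 2 =
      1 + (P * x - 1) * (1 - u * K) := by
    linear_combination (u / 2) * hK
  have hden : 1 - u / (1 + (P - 1) * (1 - u * K)) * h * (1 + x⁻¹) / 2 =
      (1 + (P * x - 1) * (1 - u * K)) / (x * (1 + (P - 1) * (1 - u * K))) := by
    rw [← hrel]
    generalize 1 + (P - 1) * (1 - u * K) = D at *
    field_simp
  rw [hden]
  generalize 1 + (P - 1) * (1 - u * K) = D at *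
  generalize 1 + (P * x - 1) * (1 - u * K) = D' at *
  field_simp

theorem strang_denominators_pos {a h : ℝ} (ha0 : 0 < a) (ha1 : a < 1) (h0 : 0 < h)
    (h1 : h ≤ 1) :
    0 < 1 - a * (h / 2) ∧ 0 < 1 - Real.exp (-h) * (a / (1 - a * (h / 2))) * (h / 2) := by
  have hah : a * h < 1 := by nlinarith
  have hd : 0 < 1 - a * (h / 2) := by linarith
  refine ⟨hd, ?_⟩
  have he : Real.exp (-h) < 1 := Real.exp_lt_one_iff.2 (by linarith)
  have hq : a / (1 - a * (h / 2)) * (h / 2) < 1 := by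
    rw [div_mul_eq_mul_div, div_lt_one hd]
    linarith
  have hq0 : 0 < a / (1 - a * (h / 2)) * (h / 2) := by positivity
  have := mul_lt_mul_of_pos_right he hq0
  rw [mul_assoc]
  linarith

theorem abs_div_sub_div_le {u K P : ℝ} (hu0 : 0 < u) (hu1 : u < 1) (hK : 1 ≤ K)
    (huK : u * K ≤ 1) (hP : 1 ≤ P) :
    |u / (1 + (P - 1) * (1 - u * K)) - u / (u + P * (1 - u))| ≤ P * (K - 1) := by
  have hD : 1 ≤ 1 + (P - 1) * (1 - u * K) := by
    have := mul_nonneg (sub_nonneg.2 hP) (sub_nonneg.2 huK)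
    linarith
  have hD' : 1 ≤ u + P * (1 - u) := by nlinarith
  have hnum : u * (u + P * (1 - u)) - (1 + (P - 1) * (1 - u * K)) * u =
      u ^ 2 * ((P - 1) * (K - 1)) := by ring
  have hPK : 0 ≤ (P - 1) * (K - 1) := mul_nonneg (sub_nonneg.2 hP) (sub_nonneg.2 hK)
  rw [div_sub_div _ _ (by linarith) (by linarith), hnum,
    abs_of_nonneg (div_nonneg (by positivity) (mul_nonneg (by linarith) (by linarith)))]
  calc u ^ 2 * ((P - 1) * (K - 1)) / ((1 + (P - 1) * (1 - u * K)) * (u + P * (1 - u)))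
      ≤ u ^ 2 * ((P - 1) * (K - 1)) :=
        div_le_self (by positivity) (one_le_mul_of_one_le_of_one_le hD hD')
    _ ≤ 1 * ((P - 1) * (K - 1)) := by
        gcongr
        exact pow_le_one₀ hu0.le hu1.le
    _ ≤ P * (K - 1) := by linarith

/-- **Second-order convergence of Strang splitting for the logistic equation.**
For `u₀ ∈ (0,1)` and `T > 0` there are `Δt₀ > 0` and `C > 0` (depending only on
`u₀` and `T`) such that for all `Δt ∈ (0, Δt₀]` the Strang splitting sequence
`a₀ = u₀`, `a_{n+1} = e^{-Δt} a_n / (1 - a_n Δt (1 + e^{-Δt})/2)` is well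
defined for all `n` with `n Δt ≤ T` (all intermediate denominators positive)
and satisfies `|a_n - u(n Δt)| ≤ C Δt²`, where
`u(t) = u₀ / (u₀ + e^t (1 - u₀))` is the exact logistic solution. -/
theorem strang_logistic_second_order (u₀ T : ℝ)
    (hu₀ : u₀ ∈ Set.Ioo (0 : ℝ) 1) (hT : 0 < T) :
    ∃ Δt₀ : ℝ, 0 < Δt₀ ∧ ∃ C : ℝ, 0 < C ∧
      ∀ Δt : ℝ, 0 < Δt → Δt ≤ Δt₀ →
        ∀ a : ℕ → ℝ, a 0 = u₀ →
          (∀ n : ℕ, a (n + 1) =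
            Real.exp (-Δt) * a n / (1 - a n * Δt * (1 + Real.exp (-Δt)) / 2)) →
          ∀ n : ℕ, (n : ℝ) * Δt ≤ T →
            (0 < 1 - a n * (Δt / 2) ∧
             0 < 1 - Real.exp (-Δt) * (a n / (1 - a n * (Δt / 2))) * (Δt / 2)) ∧
            |a n - u₀ / (u₀ + Real.exp ((n : ℝ) * Δt) * (1 - u₀))| ≤ C * Δt ^ 2 := by
  obtain ⟨hu0, hu1⟩ := hu₀
  refine ⟨1 - u₀, by linarith, Real.exp T, Real.exp_pos T, ?_⟩
  intro h h0 hh a ha hrec n hn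
  have h1 : h ≤ 1 := by linarith
  have hx : 0 < Real.exp h - 1 := sub_pos.2 (Real.one_lt_exp_iff.2 h0)
  obtain ⟨hlow, hup⟩ := exp_sub_one_bounds h0 h1
  obtain ⟨K, hK⟩ : ∃ K, 2 * K * (Real.exp h - 1) = h * (Real.exp h + 1) :=
    ⟨h * (Real.exp h + 1) / (2 * (Real.exp h - 1)), by field_simp⟩
  have hK1 : 1 ≤ K := by
    refine le_of_mul_le_mul_right ?_ hx
    linarith
  have hK2 : K ≤ 1 + h ^ 2 := by
    refine le_of_mul_le_mul_right ?_ hx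
    linarith
  have huK : u₀ * K ≤ 1 := by nlinarith
  have hP (m : ℕ) : 1 ≤ Real.exp (m * h) := Real.one_le_exp (by positivity)
  have hclosed (m : ℕ) : a m = u₀ / (1 + (Real.exp (m * h) - 1) * (1 - u₀ * K)) := by
    induction m with
    | zero => simp [ha]
    | succ m ih =>
      rw [hrec, ih, strang_step_closed_form h0 hK huK (hP m), ← Real.exp_add]
      push_cast
      ring_nf
  have hD : 1 ≤ 1 + (Real.exp (n * h) - 1) * (1 - u₀ * K) := by
    have := mul_nonneg (sub_nonneg.2 (hP n)) (sub_nonneg.2 huK)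
    linarith
  have ha0 : 0 < a n := by
    rw [hclosed]
    exact div_pos hu0 (by linarith)
  have ha1 : a n < 1 := by
    rw [hclosed]
    exact (div_le_self hu0.le hD).trans_lt hu1
  refine ⟨strang_denominators_pos ha0 ha1 h0 h1, ?_⟩
  rw [hclosed]
  calc _ ≤ Real.exp (n * h) * (K - 1) := abs_div_sub_div_le hu0 hu1 hK1 huK (hP n)
    _ ≤ Real.exp T * h ^ 2 := by
        gcongr
        linarith
end

section
/- Let E be a real Banach space, let A, B : E → E be continuously (Fréchet) differentiable, and let U ⊆ ℝ × ℝ be open. Let v : U → E be twice continuously differentiable and satisfy ∂_τ v(t,τ) = A(v(t,τ)) for all (t,τ) ∈ U. Define F : U → E by F(t,τ) = ∂_t v(t,τ) − B(v(t,τ)). Then for all (t,τ) ∈ U, ∂_τ F(t,τ) = dA(v(t,τ))[F(t,τ)] + dA(v(t,τ))[B(v(t,τ))] − dB(v(t,τ))[A(v(t,τ))]. -/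
/-- **Evolution of the forcing term `F = ∂_t v - B(v)`.**
If `v` is `C²` on an open set `U ⊆ ℝ × ℝ` and satisfies `∂_τ v = A(v)` on `U`,
then the forcing term `F(t,τ) = ∂_t v(t,τ) - B(v(t,τ))` satisfies
`∂_τ F = dA(v)[F] + dA(v)[B(v)] - dB(v)[A(v)]` on `U`. -/
theorem forcing_term_evolution {E : Type*} [NormedAddCommGroup E] [NormedSpace ℝ E]
    (A B : E → E) (hA : ContDiff ℝ 1 A) (hB : ContDiff ℝ 1 B)
    (U : Set (ℝ × ℝ)) (hU : IsOpen U)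
    (v : ℝ → ℝ → E)
    (hv : ContDiffOn ℝ 2 (fun p : ℝ × ℝ => v p.1 p.2) U)
    (hflow : ∀ p : ℝ × ℝ, p ∈ U → HasDerivAt (fun σ => v p.1 σ) (A (v p.1 p.2)) p.2)
    (F : ℝ → ℝ → E)
    (hF : ∀ p : ℝ × ℝ, p ∈ U →
      F p.1 p.2 = deriv (fun s => v s p.2) p.1 - B (v p.1 p.2)) :
    ∀ p : ℝ × ℝ, p ∈ U →
      HasDerivAt (fun σ => F p.1 σ)
        (fderiv ℝ A (v p.1 p.2) (F p.1 p.2)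
          + fderiv ℝ A (v p.1 p.2) (B (v p.1 p.2))
          - fderiv ℝ B (v p.1 p.2) (A (v p.1 p.2))) p.2 := by
  intro p hp
  have hdiff : ∀ q ∈ U, HasFDerivAt (fun p : ℝ × ℝ => v p.1 p.2)
      (fderiv ℝ (fun p : ℝ × ℝ => v p.1 p.2) q) q := fun q hq =>
    ((hv.contDiffAt (hU.mem_nhds hq)).differentiableAt (by norm_num)).hasFDerivAt
  have hw := hv.contDiffAt (hU.mem_nhds hp)
  have hsymm := hw.isSymmSndFDerivAt (by simp)
  have hw2 := ((hw.fderiv_right (m := 1) (by norm_num)).differentiableAt (by norm_num)).hasFDerivAt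
  have hvert : ∀ q : ℝ × ℝ, HasDerivAt (fun σ : ℝ => (q.1, σ)) ((0 : ℝ), (1 : ℝ)) q.2 :=
    fun q => (hasDerivAt_const q.2 q.1).prodMk (hasDerivAt_id q.2)
  have hhor : ∀ q : ℝ × ℝ, HasDerivAt (fun s : ℝ => (s, q.2)) ((1 : ℝ), (0 : ℝ)) q.1 :=
    fun q => (hasDerivAt_id q.1).prodMk (hasDerivAt_const q.1 q.2)
  have hdt : ∀ q ∈ U, deriv (fun s => v s q.2) q.1
      = fderiv ℝ (fun p : ℝ × ℝ => v p.1 p.2) q (1, 0) := fun q hq =>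
    (HasFDerivAt.comp_hasDerivAt (l := fun p : ℝ × ℝ => v p.1 p.2)
      (f := fun s => (s, q.2)) q.1 (hdiff q hq) (hhor q)).deriv
  have hdτ : ∀ q ∈ U, fderiv ℝ (fun p : ℝ × ℝ => v p.1 p.2) q (0, 1) = A (v q.1 q.2) :=
    fun q hq => (HasFDerivAt.comp_hasDerivAt (l := fun p : ℝ × ℝ => v p.1 p.2)
      (f := fun σ => (q.1, σ)) q.2 (hdiff q hq) (hvert q)).unique (hflow q hq)
  set w : ℝ × ℝ → E := fun p => v p.1 p.2 with hw_def
  have hAd : HasFDerivAt A (fderiv ℝ A (w p)) (w p) :=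
    (hA.differentiable (by norm_num) _).hasFDerivAt
  have hBd : HasFDerivAt B (fderiv ℝ B (w p)) (w p) :=
    (hB.differentiable (by norm_num) _).hasFDerivAt
  have hmixed : fderiv ℝ (fderiv ℝ w) p (1, 0) (0, 1)
      = fderiv ℝ A (w p) (fderiv ℝ w p (1, 0)) := by
    have h1 : HasFDerivAt (fun q => fderiv ℝ w q (0, 1))
        ((fderiv ℝ A (w p)).comp (fderiv ℝ w p)) p := by
      refine (hAd.comp p (hdiff p hp)).congr_of_eventuallyEq ?_
      filter_upwards [hU.mem_nhds hp] with q hq using hdτ q hq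
    have h2 := hw2.clm_apply (hasFDerivAt_const ((0 : ℝ), (1 : ℝ)) p)
    simpa using congrArg (fun L => L ((1 : ℝ), (0 : ℝ))) (h2.unique h1)
  have hFd : HasDerivAt (fun σ => F p.1 σ)
      (fderiv ℝ (fderiv ℝ w) p (0, 1) (1, 0) - fderiv ℝ B (w p) (A (w p))) p.2 := by
    have h1 : HasDerivAt (fun σ => fderiv ℝ w (p.1, σ) (1, 0))
        (fderiv ℝ (fderiv ℝ w) p (0, 1) (1, 0)) p.2 := by
      have h := HasFDerivAt.comp_hasDerivAt (l := fderiv ℝ w) (f := fun σ => (p.1, σ))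
        p.2 hw2 (hvert p)
      simpa using h.clm_apply (hasDerivAt_const p.2 ((1 : ℝ), (0 : ℝ)))
    have h2 : HasDerivAt (fun σ => B (v p.1 σ)) (fderiv ℝ B (w p) (A (w p))) p.2 :=
      HasFDerivAt.comp_hasDerivAt (l := B) (f := fun σ => v p.1 σ) p.2 hBd (hflow p hp)
    refine (h1.sub h2).congr_of_eventuallyEq ?_
    filter_upwards [(hvert p).continuousAt.preimage_mem_nhds (hU.mem_nhds hp)] with σ hσ
    exact (hF (p.1, σ) hσ).trans (congrArg (· - _) (hdt (p.1, σ) hσ))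
  convert hFd using 1
  rw [hsymm.eq, hmixed, hF p hp, hdt p hp, map_sub]
  simp [hw_def]
end

section
/- Let E be a real Banach space, let A, B : E → E be continuous maps, set C = A + B, and suppose there are a continuous linear-map-valued function dC : E → L(E,E) and a continuous symmetric bilinear map κ : E × E → E such that C(x + h) = C(x) + dC(x)[h] + (1/2) κ(h,h) for all x, h ∈ E (i.e. C is quadratic). Let I ⊆ ℝ be an open interval, let u : I → E be continuously differentiable with u'(t) = C(u(t)) for all t ∈ I, and let v be a continuously differentiable E-valued function of (t,τ) defined on a neighborhood of the diagonal {(t,t) : t ∈ I} satisfying ∂_τ v(t,τ) = A(v(t,τ)) there. Define w(t) = v(t,t) − u(t) and F(t) = ∂_t v(t,t) − B(v(t,t)). Then w is differentiable on I and w'(t) = dC(u(t))[w(t)] + F(t) + (1/2) κ(w(t), w(t)) for all t ∈ I. -/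
/-- **Evolution equation for the splitting error along the diagonal.**
Let `C = A + B` be quadratic, i.e. `C(x+h) = C(x) + dC(x)[h] + (1/2) κ(h,h)` with
`dC` a continuous linear-map-valued function and `κ` continuous symmetric bilinear.
If `u' = C(u)` on an open interval and `v(t,τ)` is `C¹` near the diagonal with
`∂_τ v = A(v)`, then the error `w(t) = v(t,t) - u(t)` satisfies
`w' = dC(u)[w] + F + (1/2) κ(w,w)`, where `F(t) = ∂_t v(t,t) - B(v(t,t))`. -/
theorem diagonal_error_evolution {E : Type*} [NormedAddCommGroup E] [NormedSpace ℝ E]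
    (A B : E → E) (hA : Continuous A) (hB : Continuous B)
    (dC : E → E →L[ℝ] E) (hdC : Continuous dC)
    (κ : E →L[ℝ] E →L[ℝ] E) (hκ : ∀ x y : E, κ x y = κ y x)
    (hquad : ∀ x h : E, A (x + h) + B (x + h)
      = A x + B x + dC x h + (1 / 2 : ℝ) • κ h h)
    (a b : ℝ) (u : ℝ → E)
    (hu : ∀ t ∈ Set.Ioo a b, HasDerivAt u (A (u t) + B (u t)) t)
    (V : Set (ℝ × ℝ)) (hV : IsOpen V)
    (hdiag : ∀ t ∈ Set.Ioo a b, (t, t) ∈ V)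
    (v : ℝ → ℝ → E)
    (hv : ContDiffOn ℝ 1 (fun p : ℝ × ℝ => v p.1 p.2) V)
    (hflow : ∀ p : ℝ × ℝ, p ∈ V → HasDerivAt (fun σ => v p.1 σ) (A (v p.1 p.2)) p.2)
    (w F : ℝ → E)
    (hw : ∀ t : ℝ, w t = v t t - u t)
    (hF : ∀ t : ℝ, F t = deriv (fun s => v s t) t - B (v t t)) :
    ∀ t ∈ Set.Ioo a b,
      HasDerivAt w (dC (u t) (w t) + F t + (1 / 2 : ℝ) • κ (w t) (w t)) t := by
  intro t ht
  have hp : (t, t) ∈ V := hdiag t ht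
  have hd : HasFDerivAt (fun p : ℝ × ℝ => v p.1 p.2)
      (fderiv ℝ (fun p : ℝ × ℝ => v p.1 p.2) (t, t)) (t, t) :=
    ((hv.contDiffAt (hV.mem_nhds hp)).differentiableAt one_ne_zero).hasFDerivAt
  set L := fderiv ℝ (fun p : ℝ × ℝ => v p.1 p.2) (t, t)
  have h_diag : HasDerivAt (fun s => v s s) (L (1, 1)) t :=
    hd.comp_hasDerivAt (f := fun s => (s, s)) t ((hasDerivAt_id t).prodMk (hasDerivAt_id t))
  have h_fst : HasDerivAt (fun s => v s t) (L (1, 0)) t :=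
    hd.comp_hasDerivAt (f := fun s => (s, t)) t ((hasDerivAt_id t).prodMk (hasDerivAt_const t t))
  have h_snd : HasDerivAt (fun s => v t s) (L (0, 1)) t :=
    hd.comp_hasDerivAt t ((hasDerivAt_const t t).prodMk (hasDerivAt_id t))
  have h_flow : L (0, 1) = A (v t t) := h_snd.unique (hflow (t, t) hp)
  have h_add : L (1, 1) = L (1, 0) + L (0, 1) := by
    rw [← map_add]
    simp
  have h_quad := hquad (u t) (w t)
  have h_v : u t + w t = v t t := by
    rw [hw]
    abel
  rw [h_v] at h_quad
  have h_w : w = fun s => v s s - u s := funext hw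
  have h_deriv : HasDerivAt w (L (1, 1) - (A (u t) + B (u t))) t := by
    rw [h_w]
    exact h_diag.sub (hu t ht)
  refine h_deriv.congr_deriv ?_
  rw [hF, h_fst.deriv, h_add, h_flow, eq_sub_of_add_eq h_quad]
  abel
end
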